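/- Thermodynamic compatibility of the augmented GLM curl-cleaning GPR model: suppose the smooth fields ρ, u, A, φ, J, ψ, S satisfy on Ω the system (i) ∂_t ρ + ∂_k(ρ u_k) = 0; (ii) ∂_t(ρ u_i) + ∂_k(ρ u_i u_k) + ∂_i p + ∂_k σ_{ik} + ∂_k ω_{ik} = ρ g_i; (iii) ∂_t A_{ik} + ∂_k(u_m A_{im}) + u_j ∂_j A_{ik} − u_j ∂_k A_{ij} + c_A ε_{ijl} ∂_j φ_{lk} = −(1/θ₁) E_{A_{ik}}; (iv) ∂_t φ_{ik} + u_j ∂_j φ_{ik} − c_A ε_{ijl} ∂_j A_{lk} = 0; (v) ∂_t J_k + ∂_k(J_m u_m) + ∂_k T + u_j(∂_j J_k − ∂_k J_j) + c_J ε_{kjl} ∂_j ψ_l = −(1/θ₂) E_{J_k}; (vi) ∂_t ψ_k + u_j ∂_j ψ_k − c_J ε_{kjl} ∂_j J_l = 0; (vii) ∂_t(ρS) + ∂_k(ρ S u_k) + ∂_k(ρ E_{J_k}) = (ρ/T)((1/θ₁) E_{A_{ik}} E_{A_{ik}} + (1/θ₂) E_{J_k} E_{J_k}). Then, with total energy density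 E := E₁ + E₂ + E₃ + E₄ + E₅ + E₆, the extra energy conservation law holds at every point of Ω: ∂_t E + ∂_k(E u_k) + ∂_k(p u_k) + ∂_k(u_i(σ_{ik} + ω_{ik})) + ∂_k q_k + ρ c_A c_s² ε_{ijl}( A_{im} G̊_{mk} ∂_j φ_{lk} + φ_{lm} D̊_{mk} ∂_j A_{ik} ) + c_J c_h² ε_{kjl}( ρ ψ_l ∂_j J_k + ρ J_k ∂_j ψ_l ) = ρ g_i u_i. -/

import Mathlib

/-!
Thermodynamic compatibility of the augmented GLM curl-cleaning GPR model.
-/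

noncomputable section

open scoped BigOperators

/-- A space-time point: (spatial coordinates in ℝ³, time). -/
abbrev Pt : Type := (Fin 3 → ℝ) × ℝ

/-- Spatial partial derivative in the `k`-th coordinate direction. -/
def pd (k : Fin 3) (f : Pt → ℝ) (x : Pt) : ℝ :=
  fderiv ℝ f x ((Pi.single k 1 : Fin 3 → ℝ), (0 : ℝ))

/-- Time derivative. -/
def pdt (f : Pt → ℝ) (x : Pt) : ℝ :=
  fderiv ℝ f x ((0 : Fin 3 → ℝ), (1 : ℝ))

/-- Levi-Civita symbol on `Fin 3`. -/
def eps (i j l : Fin 3) : ℝ :=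
  if (i, j, l) = (0, 1, 2) ∨ (i, j, l) = (1, 2, 0) ∨ (i, j, l) = (2, 0, 1) then 1
  else if (i, j, l) = (2, 1, 0) ∨ (i, j, l) = (1, 0, 2) ∨ (i, j, l) = (0, 2, 1) then -1
  else 0

/-- Trace-free (deviatoric) part of a 3×3 matrix. -/
def dev (M : Fin 3 → Fin 3 → ℝ) (i k : Fin 3) : ℝ :=
  M i k - (1 / 3) * (∑ m, M m m) * (if i = k then (1 : ℝ) else 0)

/-- Metric tensor `G = AᵀA` of a matrix field, at a point. -/
def Gm (A : Fin 3 → Fin 3 → Pt → ℝ) (x : Pt) (i k : Fin 3) : ℝ :=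
  ∑ j, A j i x * A j k x

/-- Ideal-gas internal energy density `E₁ = ρ^γ e^{S/c_v}/(γ-1)`. -/
def E1 (γ cv : ℝ) (ρ S : Pt → ℝ) (x : Pt) : ℝ :=
  ρ x ^ γ * Real.exp (S x / cv) / (γ - 1)

/-- Pressure `p = (γ-1) E₁`. -/
def press (γ cv : ℝ) (ρ S : Pt → ℝ) (x : Pt) : ℝ :=
  (γ - 1) * E1 γ cv ρ S x

/-- Temperature `T = E₁ / (ρ c_v)`. -/
def temp (γ cv : ℝ) (ρ S : Pt → ℝ) (x : Pt) : ℝ :=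
  E1 γ cv ρ S x / (ρ x * cv)

/-- Kinetic energy density `E₂ = ½ ρ |u|²`. -/
def E2 (ρ : Pt → ℝ) (u : Fin 3 → Pt → ℝ) (x : Pt) : ℝ :=
  (1 / 2) * ρ x * ∑ i, u i x * u i x

/-- Mesoscopic distortion energy density `E₃ = ¼ c_s² ρ G̊:G̊` (also used
for the cleaning energy `E₅` with `A` replaced by `φ`). -/
def E3 (cs : ℝ) (ρ : Pt → ℝ) (A : Fin 3 → Fin 3 → Pt → ℝ) (x : Pt) : ℝ :=
  (1 / 4) * cs ^ 2 * ρ x * ∑ i, ∑ k, dev (Gm A x) i k * dev (Gm A x) i k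

/-- Thermal-impulse energy density `E₄ = ½ c_h² ρ |J|²` (also used for
the cleaning energy `E₆` with `J` replaced by `ψ`). -/
def E4 (ch : ℝ) (ρ : Pt → ℝ) (J : Fin 3 → Pt → ℝ) (x : Pt) : ℝ :=
  (1 / 2) * ch ^ 2 * ρ x * ∑ k, J k x * J k x

/-- Shear stress `σ_{ik} = ρ c_s² G_{ij} G̊_{jk}`. -/
def sigm (cs : ℝ) (ρ : Pt → ℝ) (A : Fin 3 → Fin 3 → Pt → ℝ) (i k : Fin 3) (x : Pt) : ℝ :=
  ρ x * cs ^ 2 * ∑ j, Gm A x i j * dev (Gm A x) j k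

/-- Thermal stress `ω_{ik} = ρ c_h² J_i J_k`. -/
def omeg (ch : ℝ) (ρ : Pt → ℝ) (J : Fin 3 → Pt → ℝ) (i k : Fin 3) (x : Pt) : ℝ :=
  ρ x * ch ^ 2 * J i x * J k x

/-- Heat flux `q_k = ρ c_h² T J_k`. -/
def heatq (γ cv ch : ℝ) (ρ S : Pt → ℝ) (J : Fin 3 → Pt → ℝ) (k : Fin 3) (x : Pt) : ℝ :=
  ρ x * ch ^ 2 * temp γ cv ρ S x * J k x

/-- Specific-energy derivative `E_{A_{ik}} = c_s² A_{ij} G̊_{jk}`. -/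
def EA (cs : ℝ) (A : Fin 3 → Fin 3 → Pt → ℝ) (i k : Fin 3) (x : Pt) : ℝ :=
  cs ^ 2 * ∑ j, A i j x * dev (Gm A x) j k

/-- Specific-energy derivative `E_{J_k} = c_h² J_k`. -/
def EJ (ch : ℝ) (J : Fin 3 → Pt → ℝ) (k : Fin 3) (x : Pt) : ℝ :=
  ch ^ 2 * J k x

/-- Total energy density `E = E₁ + E₂ + E₃ + E₄ + E₅ + E₆` of the augmented
GLM curl-cleaning GPR model. -/
def Etot (γ cv cs ch : ℝ) (ρ S : Pt → ℝ) (u J ψ : Fin 3 → Pt → ℝ)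
    (A φ : Fin 3 → Fin 3 → Pt → ℝ) (x : Pt) : ℝ :=
  E1 γ cv ρ S x + E2 ρ u x + E3 cs ρ A x + E4 ch ρ J x + E3 cs ρ φ x + E4 ch ρ ψ x

section Algebra

theorem dev_symm {M : Fin 3 → Fin 3 → ℝ} (hM : ∀ i k, M i k = M k i) (i k : Fin 3) :
    dev M i k = dev M k i := by
  simp only [dev, hM i k, eq_comm]

/-- The trace-free part is an orthogonal projection. -/
theorem sum_dev_mul_dev (M N : Fin 3 → Fin 3 → ℝ) :
    ∑ i, ∑ k, dev M i k * dev N i k = ∑ i, ∑ k, dev M i k * N i k := by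
  simp [dev, Fin.sum_univ_three]
  ring

theorem sum_symm_mul_gram {H : Fin 3 → Fin 3 → ℝ} (hH : ∀ i k, H i k = H k i)
    (a b : Fin 3 → Fin 3 → ℝ) :
    ∑ i, ∑ k, H i k * ∑ j, (b j i * a j k + a j i * b j k)
      = 2 * ∑ i, ∑ k, (∑ j, a i j * H j k) * b i k := by
  simp only [Fin.sum_univ_three, hH 1 0, hH 2 0, hH 2 1]
  ring

/-- The pairing of two matrix fields with each other's curls, written with a single
Levi-Civita symbol. -/
theorem sum_eps_mul_matrix (P Q : Fin 3 → Fin 3 → ℝ) (X Y : Fin 3 → Fin 3 → Fin 3 → ℝ) :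
    ∑ i, ∑ j, ∑ l, eps i j l * (∑ k, P i k * X j l k + ∑ k, Q l k * Y j i k)
      = ∑ i, ∑ k, P i k * (∑ j, ∑ l, eps i j l * X j l k)
        - ∑ i, ∑ k, Q i k * (∑ j, ∑ l, eps i j l * Y j l k) := by
  simp [eps, Fin.sum_univ_three]
  ring

theorem sum_eps_mul_vector (p q : Fin 3 → ℝ) (X Y : Fin 3 → Fin 3 → ℝ) :
    ∑ k, ∑ j, ∑ l, eps k j l * (q l * Y j k + p k * X j l)
      = ∑ k, p k * (∑ j, ∑ l, eps k j l * X j l)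
        - ∑ k, q k * (∑ j, ∑ l, eps k j l * Y j l) := by
  simp [eps, Fin.sum_univ_three]
  ring

end Algebra

section Derivatives

variable {x v : Pt}

theorem fderiv_mul_apply {f g : Pt → ℝ} (hf : DifferentiableAt ℝ f x)
    (hg : DifferentiableAt ℝ g x) :
    fderiv ℝ (fun y => f y * g y) x v = fderiv ℝ f x v * g x + f x * fderiv ℝ g x v := by
  rw [fderiv_fun_mul hf hg]
  simp
  ring

theorem fderiv_sum_apply {f : Fin 3 → Pt → ℝ} (hf : ∀ i, DifferentiableAt ℝ (f i) x) :
    fderiv ℝ (fun y => ∑ i, f i y) x v = ∑ i, fderiv ℝ (f i) x v := by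
  rw [fderiv_fun_sum fun i _ => hf i]
  simp

theorem pd_mul (k : Fin 3) {f g : Pt → ℝ} (hf : DifferentiableAt ℝ f x)
    (hg : DifferentiableAt ℝ g x) :
    pd k (fun y => f y * g y) x = pd k f x * g x + f x * pd k g x :=
  fderiv_mul_apply hf hg

theorem pd_sum (k : Fin 3) {f : Fin 3 → Pt → ℝ} (hf : ∀ i, DifferentiableAt ℝ (f i) x) :
    pd k (fun y => ∑ i, f i y) x = ∑ i, pd k (f i) x :=
  fderiv_sum_apply hf

/-- The material derivative `∂_t + u_k ∂_k` is the derivative in direction `(u, 1)`. -/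
theorem pdt_add_sum_mul_pd (f : Pt → ℝ) (w : Fin 3 → ℝ) :
    pdt f x + ∑ k, w k * pd k f x = fderiv ℝ f x (w, 1) := by
  have h : ((w, 1) : Pt) = (0, 1) + ∑ k, w k • ((Pi.single k 1 : Fin 3 → ℝ), (0 : ℝ)) := by
    ext i
    · fin_cases i <;> simp [Fin.sum_univ_three]
    · simp [Fin.sum_univ_three]
  rw [h, map_add, map_sum]
  simp only [map_smul, smul_eq_mul, pdt, pd]

theorem pdt_add_sum_pd_mul {f : Pt → ℝ} {u : Fin 3 → Pt → ℝ} (hf : DifferentiableAt ℝ f x)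
    (hu : ∀ k, DifferentiableAt ℝ (u k) x) :
    pdt f x + ∑ k, pd k (fun y => f y * u k y) x
      = fderiv ℝ f x (fun k => u k x, 1) + f x * ∑ k, pd k (u k) x := by
  rw [← pdt_add_sum_mul_pd, Finset.mul_sum, add_assoc, ← Finset.sum_add_distrib]
  congr 1
  refine Finset.sum_congr rfl fun k _ => ?_
  rw [pd_mul k hf (hu k)]
  ring

theorem differentiableAt_E1 {γ cv : ℝ} {ρ S : Pt → ℝ} (hρ : DifferentiableAt ℝ ρ x)
    (hS : DifferentiableAt ℝ S x) (hpos : 0 < ρ x) : DifferentiableAt ℝ (E1 γ cv ρ S) x := by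
  have := hρ.rpow_const (p := γ) (Or.inl hpos.ne')
  unfold E1
  fun_prop

theorem differentiableAt_Gm {A : Fin 3 → Fin 3 → Pt → ℝ}
    (hA : ∀ i k, DifferentiableAt ℝ (A i k) x) (i k : Fin 3) :
    DifferentiableAt ℝ (fun y => Gm A y i k) x := by
  unfold Gm
  fun_prop

theorem differentiableAt_dev_Gm {A : Fin 3 → Fin 3 → Pt → ℝ}
    (hA : ∀ i k, DifferentiableAt ℝ (A i k) x) (i k : Fin 3) :
    DifferentiableAt ℝ (fun y => dev (Gm A y) i k) x := by
  have := differentiableAt_Gm hA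
  unfold dev
  fun_prop

theorem differentiableAt_E3 {cs : ℝ} {ρ : Pt → ℝ} {A : Fin 3 → Fin 3 → Pt → ℝ}
    (hρ : DifferentiableAt ℝ ρ x) (hA : ∀ i k, DifferentiableAt ℝ (A i k) x) :
    DifferentiableAt ℝ (E3 cs ρ A) x := by
  have := differentiableAt_dev_Gm hA
  unfold E3
  fun_prop

theorem differentiableAt_sigm {cs : ℝ} {ρ : Pt → ℝ} {A : Fin 3 → Fin 3 → Pt → ℝ}
    (hρ : DifferentiableAt ℝ ρ x) (hA : ∀ i k, DifferentiableAt ℝ (A i k) x) (i k : Fin 3) :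
    DifferentiableAt ℝ (sigm cs ρ A i k) x := by
  have := differentiableAt_dev_Gm hA
  have := differentiableAt_Gm hA
  unfold sigm
  fun_prop

theorem fderiv_E1 {γ cv : ℝ} {ρ S : Pt → ℝ} (hρ : DifferentiableAt ℝ ρ x)
    (hS : DifferentiableAt ℝ S x) (hpos : 0 < ρ x) :
    fderiv ℝ (E1 γ cv ρ S) x v
      = γ * E1 γ cv ρ S x / ρ x * fderiv ℝ ρ x v + E1 γ cv ρ S x / cv * fderiv ℝ S x v := by
  have h := (((hρ.hasFDerivAt.rpow_const (p := γ) (Or.inl hpos.ne')).mul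
    (hS.hasFDerivAt.mul_const cv⁻¹).exp).mul_const (γ - 1)⁻¹)
  have h' : HasFDerivAt (E1 γ cv ρ S) _ x := h
  rw [h'.fderiv]
  simp only [E1, Real.rpow_sub_one hpos.ne', FunLike.coe_smul, FunLike.coe_add, Pi.smul_apply,
    Pi.add_apply, smul_eq_mul, div_eq_mul_inv]
  ring

theorem fderiv_E2 {ρ : Pt → ℝ} {u : Fin 3 → Pt → ℝ} (hρ : DifferentiableAt ℝ ρ x)
    (hu : ∀ k, DifferentiableAt ℝ (u k) x) :
    fderiv ℝ (E2 ρ u) x v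
      = (1 / 2 * ∑ i, u i x * u i x) * fderiv ℝ ρ x v
        + ρ x * ∑ i, u i x * fderiv ℝ (u i) x v := by
  unfold E2
  rw [fderiv_mul_apply (by fun_prop) (by fun_prop), fderiv_const_mul hρ,
    fderiv_sum_apply (by fun_prop)]
  simp only [fderiv_mul_apply (hu _) (hu _), Fin.sum_univ_three, FunLike.coe_smul,
    Pi.smul_apply, smul_eq_mul]
  ring

theorem fderiv_E4 {ch : ℝ} {ρ : Pt → ℝ} {J : Fin 3 → Pt → ℝ} (hρ : DifferentiableAt ℝ ρ x)
    (hJ : ∀ k, DifferentiableAt ℝ (J k) x) :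
    fderiv ℝ (E4 ch ρ J) x v
      = (1 / 2 * ch ^ 2 * ∑ k, J k x * J k x) * fderiv ℝ ρ x v
        + ρ x * ∑ k, EJ ch J k x * fderiv ℝ (J k) x v := by
  unfold E4 EJ
  rw [fderiv_mul_apply (by fun_prop) (by fun_prop), fderiv_const_mul hρ,
    fderiv_sum_apply (by fun_prop)]
  simp only [fderiv_mul_apply (hJ _) (hJ _), Fin.sum_univ_three, FunLike.coe_smul,
    Pi.smul_apply, smul_eq_mul]
  ring

theorem Gm_symm (A : Fin 3 → Fin 3 → Pt → ℝ) (y : Pt) (i k : Fin 3) :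
    Gm A y i k = Gm A y k i := by
  simp only [Gm, mul_comm]

theorem fderiv_dev_Gm {A : Fin 3 → Fin 3 → Pt → ℝ}
    (hA : ∀ i k, DifferentiableAt ℝ (A i k) x) (i k : Fin 3) :
    fderiv ℝ (fun y => dev (Gm A y) i k) x v
      = dev (fun i k => fderiv ℝ (fun y => Gm A y i k) x v) i k := by
  have hG := differentiableAt_Gm hA
  unfold dev
  rw [fderiv_fun_sub (hG i k) (by fun_prop), fderiv_mul_const (by fun_prop),
    fderiv_const_mul (by fun_prop)]
  simp only [FunLike.coe_sub, Pi.sub_apply, FunLike.coe_smul, Pi.smul_apply, smul_eq_mul]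
  rw [fderiv_sum_apply fun m => hG m m]
  ring

theorem fderiv_Gm {A : Fin 3 → Fin 3 → Pt → ℝ}
    (hA : ∀ i k, DifferentiableAt ℝ (A i k) x) (i k : Fin 3) :
    fderiv ℝ (fun y => Gm A y i k) x v
      = ∑ j, (fderiv ℝ (A j i) x v * A j k x + A j i x * fderiv ℝ (A j k) x v) := by
  unfold Gm
  rw [fderiv_sum_apply fun j => (hA j i).fun_mul (hA j k)]
  simp only [fderiv_mul_apply (hA _ _) (hA _ _)]

theorem fderiv_E3 {cs : ℝ} {ρ : Pt → ℝ} {A : Fin 3 → Fin 3 → Pt → ℝ}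
    (hρ : DifferentiableAt ℝ ρ x) (hA : ∀ i k, DifferentiableAt ℝ (A i k) x) :
    fderiv ℝ (E3 cs ρ A) x v
      = (1 / 4 * cs ^ 2 * ∑ i, ∑ k, dev (Gm A x) i k * dev (Gm A x) i k) * fderiv ℝ ρ x v
        + ρ x * ∑ i, ∑ k, EA cs A i k x * fderiv ℝ (A i k) x v := by
  have hD := differentiableAt_dev_Gm hA
  have key : ∑ i, ∑ k, dev (Gm A x) i k * fderiv ℝ (fun y => dev (Gm A y) i k) x v
      = 2 * ∑ i, ∑ k, (∑ j, A i j x * dev (Gm A x) j k) * fderiv ℝ (A i k) x v := by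
    simp only [fderiv_dev_Gm hA]
    rw [sum_dev_mul_dev]
    simp only [fderiv_Gm hA]
    exact sum_symm_mul_gram (dev_symm (Gm_symm A x)) (fun i k => A i k x)
      fun i k => fderiv ℝ (A i k) x v
  have hsum : fderiv ℝ (fun y => ∑ i, ∑ k, dev (Gm A y) i k * dev (Gm A y) i k) x v
      = 2 * ∑ i, ∑ k, dev (Gm A x) i k * fderiv ℝ (fun y => dev (Gm A y) i k) x v := by
    rw [fderiv_sum_apply (by fun_prop), Finset.mul_sum]
    refine Finset.sum_congr rfl fun i _ => ?_
    rw [fderiv_sum_apply (by fun_prop), Finset.mul_sum]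
    refine Finset.sum_congr rfl fun k _ => ?_
    rw [fderiv_mul_apply (hD i k) (hD i k)]
    ring
  have hEA : ∑ i, ∑ k, EA cs A i k x * fderiv ℝ (A i k) x v
      = cs ^ 2 * ∑ i, ∑ k, (∑ j, A i j x * dev (Gm A x) j k) * fderiv ℝ (A i k) x v := by
    simp only [EA, Finset.mul_sum, mul_assoc, Finset.sum_mul]
  unfold E3
  rw [fderiv_mul_apply (by fun_prop) (by fun_prop), fderiv_const_mul hρ, hsum, key, hEA]
  simp only [FunLike.coe_smul, Pi.smul_apply, smul_eq_mul]
  ring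

end Derivatives

/-- The shear stress is `ρ Aᵀ E_A`. -/
theorem sigm_eq_sum_mul_EA (cs : ℝ) (ρ : Pt → ℝ) (A : Fin 3 → Fin 3 → Pt → ℝ) (m k : Fin 3)
    (x : Pt) : sigm cs ρ A m k x = ρ x * ∑ i, A i m x * EA cs A i k x := by
  simp only [sigm, Gm, EA, Fin.sum_univ_three]
  ring

/-- **Thermodynamic compatibility of the augmented GLM curl-cleaning GPR model.**
If the smooth fields `ρ, u, A, φ, J, ψ, S` satisfy the GLM GPR system
(mass, momentum, distortion, φ-cleaning, thermal impulse, ψ-cleaning, entropy)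
on the open set `Ω`, then the extra energy conservation law holds pointwise on `Ω`. -/
theorem glm_gpr_thermodynamically_compatible
    (Ω : Set Pt) (hΩ : IsOpen Ω)
    (cs ch cA cJ γ cv : ℝ) (g : Fin 3 → ℝ)
    (hcs : 0 ≤ cs) (hch : 0 ≤ ch) (hcA : 0 ≤ cA) (hcJ : 0 ≤ cJ)
    (hγ : 1 < γ) (hcv : 0 < cv)
    (ρ S θ₁ θ₂ : Pt → ℝ) (u J ψ : Fin 3 → Pt → ℝ)
    (A φ : Fin 3 → Fin 3 → Pt → ℝ)
    (hρ : ContDiffOn ℝ (⊤ : ℕ∞) ρ Ω) (hρpos : ∀ x ∈ Ω, 0 < ρ x)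
    (hS : ContDiffOn ℝ (⊤ : ℕ∞) S Ω)
    (hθ₁ : ContDiffOn ℝ (⊤ : ℕ∞) θ₁ Ω) (hθ₁ne : ∀ x ∈ Ω, θ₁ x ≠ 0)
    (hθ₂ : ContDiffOn ℝ (⊤ : ℕ∞) θ₂ Ω) (hθ₂ne : ∀ x ∈ Ω, θ₂ x ≠ 0)
    (hu : ∀ i, ContDiffOn ℝ (⊤ : ℕ∞) (u i) Ω)
    (hJ : ∀ k, ContDiffOn ℝ (⊤ : ℕ∞) (J k) Ω)
    (hψ : ∀ k, ContDiffOn ℝ (⊤ : ℕ∞) (ψ k) Ω)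
    (hA : ∀ i k, ContDiffOn ℝ (⊤ : ℕ∞) (A i k) Ω)
    (hφ : ∀ i k, ContDiffOn ℝ (⊤ : ℕ∞) (φ i k) Ω)
    -- (i) conservation of mass
    (hmass : ∀ x ∈ Ω,
      pdt ρ x + ∑ k, pd k (fun y => ρ y * u k y) x = 0)
    -- (ii) momentum balance
    (hmom : ∀ x ∈ Ω, ∀ i,
      pdt (fun y => ρ y * u i y) x
        + ∑ k, pd k (fun y => ρ y * u i y * u k y) x
        + pd i (press γ cv ρ S) x
        + ∑ k, pd k (sigm cs ρ A i k) x
        + ∑ k, pd k (omeg ch ρ J i k) x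
      = ρ x * g i)
    -- (iii) distortion field with GLM cleaning
    (hdist : ∀ x ∈ Ω, ∀ i k,
      pdt (A i k) x
        + pd k (fun y => ∑ m, u m y * A i m y) x
        + ∑ j, u j x * pd j (A i k) x
        - ∑ j, u j x * pd k (A i j) x
        + cA * ∑ j, ∑ l, eps i j l * pd j (φ l k) x
      = -(1 / θ₁ x) * EA cs A i k x)
    -- (iv) cleaning field φ
    (hphi : ∀ x ∈ Ω, ∀ i k,
      pdt (φ i k) x + ∑ j, u j x * pd j (φ i k) x
        - cA * ∑ j, ∑ l, eps i j l * pd j (A l k) x = 0)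
    -- (v) thermal impulse with GLM cleaning
    (hJeq : ∀ x ∈ Ω, ∀ k,
      pdt (J k) x
        + pd k (fun y => ∑ m, J m y * u m y) x
        + pd k (temp γ cv ρ S) x
        + ∑ j, u j x * (pd j (J k) x - pd k (J j) x)
        + cJ * ∑ j, ∑ l, eps k j l * pd j (ψ l) x
      = -(1 / θ₂ x) * EJ ch J k x)
    -- (vi) cleaning field ψ
    (hpsi : ∀ x ∈ Ω, ∀ k,
      pdt (ψ k) x + ∑ j, u j x * pd j (ψ k) x
        - cJ * ∑ j, ∑ l, eps k j l * pd j (J l) x = 0)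
    -- (vii) entropy balance
    (hent : ∀ x ∈ Ω,
      pdt (fun y => ρ y * S y) x
        + ∑ k, pd k (fun y => ρ y * S y * u k y) x
        + ∑ k, pd k (fun y => ρ y * EJ ch J k y) x
      = (ρ x / temp γ cv ρ S x) *
          ((1 / θ₁ x) * ∑ i, ∑ k, EA cs A i k x * EA cs A i k x
            + (1 / θ₂ x) * ∑ k, EJ ch J k x * EJ ch J k x)) :
    -- extra energy conservation law
    ∀ x ∈ Ω,
      pdt (Etot γ cv cs ch ρ S u J ψ A φ) x
        + ∑ k, pd k (fun y => Etot γ cv cs ch ρ S u J ψ A φ y * u k y) x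
        + ∑ k, pd k (fun y => press γ cv ρ S y * u k y) x
        + ∑ i, ∑ k, pd k (fun y => u i y * (sigm cs ρ A i k y + omeg ch ρ J i k y)) x
        + ∑ k, pd k (heatq γ cv ch ρ S J k) x
        + ρ x * cA * cs ^ 2 *
            ∑ i, ∑ j, ∑ l, eps i j l *
              ((∑ m, ∑ k, A i m x * dev (Gm A x) m k * pd j (φ l k) x)
                + (∑ m, ∑ k, φ l m x * dev (Gm φ x) m k * pd j (A i k) x))
        + cJ * ch ^ 2 *
            ∑ k, ∑ j, ∑ l, eps k j l *
              (ρ x * ψ l x * pd j (J k) x + ρ x * J k x * pd j (ψ l) x)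
      = ρ x * ∑ i, g i * u i x := by
  intro x hx
  have hd {f : Pt → ℝ} (hf : ContDiffOn ℝ (⊤ : ℕ∞) f Ω) : DifferentiableAt ℝ f x :=
    (hf.contDiffAt (hΩ.mem_nhds hx)).differentiableAt (by simp)
  replace hρ := hd hρ
  replace hS := hd hS
  replace hu := fun i => hd (hu i)
  replace hJ := fun i => hd (hJ i)
  replace hψ := fun i => hd (hψ i)
  replace hA := fun i k => hd (hA i k)
  replace hφ := fun i k => hd (hφ i k)
  have hpos := hρpos x hx
  have hρ0 := hpos.ne'
  have hE1 : DifferentiableAt ℝ (E1 γ cv ρ S) x := differentiableAt_E1 hρ hS hpos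
  have hp : DifferentiableAt ℝ (press γ cv ρ S) x := hE1.const_mul _
  have hT : DifferentiableAt ℝ (temp γ cv ρ S) x := by
    have := (mul_pos hpos hcv).ne'
    unfold temp
    fun_prop (disch := assumption)
  have hE1pos : 0 < E1 γ cv ρ S x :=
    div_pos (mul_pos (Real.rpow_pos_of_pos hpos _) (Real.exp_pos _)) (sub_pos.2 hγ)
  have hTpos : 0 < temp γ cv ρ S x := div_pos hE1pos (mul_pos hpos hcv)
  have hE1T : E1 γ cv ρ S x / cv = ρ x * temp γ cv ρ S x := by
    simp only [temp]
    field_simp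
  have hE2 : DifferentiableAt ℝ (E2 ρ u) x := by unfold E2; fun_prop
  have hE4 (K : Fin 3 → Pt → ℝ) (hK : ∀ k, DifferentiableAt ℝ (K k) x) :
      DifferentiableAt ℝ (E4 ch ρ K) x := by unfold E4; fun_prop
  have hσ : ∀ i k, DifferentiableAt ℝ (sigm cs ρ A i k) x := differentiableAt_sigm hρ hA
  have hω (i k : Fin 3) : DifferentiableAt ℝ (omeg ch ρ J i k) x := by unfold omeg; fun_prop
  have hEJ (k : Fin 3) : DifferentiableAt ℝ (EJ ch J k) x := by unfold EJ; fun_prop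
  have hE : DifferentiableAt ℝ (Etot γ cv cs ch ρ S u J ψ A φ) x :=
    ((((hE1.add hE2).add (differentiableAt_E3 hρ hA)).add (hE4 J hJ)).add
      (differentiableAt_E3 hρ hφ)).add (hE4 ψ hψ)
  set V : Pt := (fun k => u k x, 1) with hV
  set d : ℝ := ∑ k, pd k (u k) x with hdiv
  -- the balance laws in terms of the material derivative
  have mass : fderiv ℝ ρ x V = -ρ x * d := by
    have := hmass x hx
    rw [pdt_add_sum_pd_mul hρ hu] at this
    linarith
  have mom (i : Fin 3) : ρ x * fderiv ℝ (u i) x V = ρ x * g i - pd i (press γ cv ρ S) x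
      - ∑ k, pd k (sigm cs ρ A i k) x - ∑ k, pd k (omeg ch ρ J i k) x := by
    have := hmom x hx i
    rw [pdt_add_sum_pd_mul (hρ.fun_mul (hu i)) hu, fderiv_mul_apply hρ (hu i), ← hV, mass] at this
    linarith
  have dist (i k : Fin 3) : fderiv ℝ (A i k) x V = -(∑ m, A i m x * pd k (u m) x)
      - cA * (∑ j, ∑ l, eps i j l * pd j (φ l k) x) - 1 / θ₁ x * EA cs A i k x := by
    have := hdist x hx i k
    rw [pd_sum k (fun m => (hu m).fun_mul (hA i m))] at this
    simp only [pd_mul k (hu _) (hA i _), Finset.sum_add_distrib] at this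
    rw [hV, ← pdt_add_sum_mul_pd]
    simp only [mul_comm (A i _ x)]
    linarith
  have phi (i k : Fin 3) :
      fderiv ℝ (φ i k) x V = cA * ∑ j, ∑ l, eps i j l * pd j (A l k) x := by
    have := hphi x hx i k
    rw [hV, ← pdt_add_sum_mul_pd]
    linarith
  have imp (k : Fin 3) : fderiv ℝ (J k) x V = -(∑ m, J m x * pd k (u m) x)
      - pd k (temp γ cv ρ S) x - cJ * (∑ j, ∑ l, eps k j l * pd j (ψ l) x)
      - 1 / θ₂ x * EJ ch J k x := by
    have := hJeq x hx k
    rw [pd_sum k (fun m => (hJ m).fun_mul (hu m))] at this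
    simp only [pd_mul k (hJ _) (hu _), Finset.sum_add_distrib, mul_sub,
      Finset.sum_sub_distrib, mul_comm (pd k (J _) x)] at this
    rw [hV, ← pdt_add_sum_mul_pd]
    linarith
  have psi (k : Fin 3) :
      fderiv ℝ (ψ k) x V = cJ * ∑ j, ∑ l, eps k j l * pd j (J l) x := by
    have := hpsi x hx k
    rw [hV, ← pdt_add_sum_mul_pd]
    linarith
  have ent : ρ x * temp γ cv ρ S x * fderiv ℝ S x V
      = ρ x * (1 / θ₁ x * ∑ i, ∑ k, EA cs A i k x * EA cs A i k x
          + 1 / θ₂ x * ∑ k, EJ ch J k x * EJ ch J k x)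
        - temp γ cv ρ S x * ∑ k, pd k (fun y => ρ y * EJ ch J k y) x := by
    have := hent x hx
    rw [pdt_add_sum_pd_mul (hρ.fun_mul hS) hu, fderiv_mul_apply hρ hS, ← hV, mass] at this
    rw [div_mul_eq_mul_div, eq_div_iff hTpos.ne'] at this
    linarith
  -- the terms of the energy balance
  have hEV : fderiv ℝ (Etot γ cv cs ch ρ S u J ψ A φ) x V
      = fderiv ℝ (E1 γ cv ρ S) x V + fderiv ℝ (E2 ρ u) x V + fderiv ℝ (E3 cs ρ A) x V
        + fderiv ℝ (E4 ch ρ J) x V + fderiv ℝ (E3 cs ρ φ) x V + fderiv ℝ (E4 ch ρ ψ) x V := by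
    have h := ((((hE1.hasFDerivAt.add hE2.hasFDerivAt).add
      (differentiableAt_E3 (cs := cs) hρ hA).hasFDerivAt).add (hE4 J hJ).hasFDerivAt).add
      (differentiableAt_E3 (cs := cs) hρ hφ).hasFDerivAt).add (hE4 ψ hψ).hasFDerivAt
    have h' : HasFDerivAt (Etot γ cv cs ch ρ S u J ψ A φ) _ x := h
    rw [h'.fderiv]
    rfl
  have energy1 : fderiv ℝ (E1 γ cv ρ S) x V
      = -γ * E1 γ cv ρ S x * d + ρ x * temp γ cv ρ S x * fderiv ℝ S x V := by
    rw [fderiv_E1 hρ hS hpos, mass, hE1T]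
    field_simp
  have heat (k : Fin 3) : pd k (heatq γ cv ch ρ S J k) x
      = pd k (fun y => ρ y * EJ ch J k y) x * temp γ cv ρ S x
        + ρ x * EJ ch J k x * pd k (temp γ cv ρ S) x := by
    rw [← pd_mul k (hρ.fun_mul (hEJ k)) hT]
    congr 1
    ext y
    simp only [heatq, EJ]
    ring
  have stress (i k : Fin 3) :
      pd k (fun y => u i y * (sigm cs ρ A i k y + omeg ch ρ J i k y)) x
        = pd k (u i) x * (ρ x * ∑ j, A j i x * EA cs A j k x + ρ x * J i x * EJ ch J k x)
          + u i x * (pd k (sigm cs ρ A i k) x + pd k (omeg ch ρ J i k) x) := by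
    rw [pd_mul k (hu i) ((hσ i k).fun_add (hω i k)), sigm_eq_sum_mul_EA]
    simp only [pd]
    rw [fderiv_fun_add (hσ i k) (hω i k)]
    simp only [omeg, EJ, FunLike.coe_add, Pi.add_apply]
    ring
  have cleanA : ρ x * cA * cs ^ 2 * ∑ i, ∑ j, ∑ l, eps i j l *
        ((∑ m, ∑ k, A i m x * dev (Gm A x) m k * pd j (φ l k) x)
          + (∑ m, ∑ k, φ l m x * dev (Gm φ x) m k * pd j (A i k) x))
      = ρ x * cA * (∑ i, ∑ k, EA cs A i k x * (∑ j, ∑ l, eps i j l * pd j (φ l k) x)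
        - ∑ i, ∑ k, EA cs φ i k x * (∑ j, ∑ l, eps i j l * pd j (A l k) x)) := by
    rw [← sum_eps_mul_matrix (fun i k => EA cs A i k x) (fun i k => EA cs φ i k x)
      (fun j l k => pd j (φ l k) x) (fun j l k => pd j (A l k) x), mul_assoc, Finset.mul_sum]
    congr 1
    refine Finset.sum_congr rfl fun i _ => ?_
    rw [Finset.mul_sum]
    refine Finset.sum_congr rfl fun j _ => ?_
    rw [Finset.mul_sum]
    refine Finset.sum_congr rfl fun l _ => ?_
    simp only [EA, Fin.sum_univ_three]
    ring
  have cleanJ : cJ * ch ^ 2 * ∑ k, ∑ j, ∑ l, eps k j l *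
        (ρ x * ψ l x * pd j (J k) x + ρ x * J k x * pd j (ψ l) x)
      = ρ x * cJ * (∑ k, EJ ch J k x * (∑ j, ∑ l, eps k j l * pd j (ψ l) x)
        - ∑ k, EJ ch ψ k x * (∑ j, ∑ l, eps k j l * pd j (J l) x)) := by
    rw [sum_eps_mul_vector (fun k => ρ x * J k x) (fun k => ρ x * ψ k x)
      (fun j l => pd j (ψ l) x) (fun j l => pd j (J l) x)]
    simp only [EJ, Fin.sum_univ_three]
    ring
  have hpd : ∑ k, pd k (fun y => press γ cv ρ S y * u k y) x
      = (γ - 1) * E1 γ cv ρ S x * d + ∑ k, u k x * pd k (press γ cv ρ S) x := by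
    simp only [pd_mul _ hp (hu _), Finset.sum_add_distrib, ← Finset.mul_sum]
    rw [add_comm]
    simp only [mul_comm (u _ x)]
    rfl
  have energyu : ρ x * ∑ i, u i x * fderiv ℝ (u i) x V
      = ∑ i, u i x * (ρ x * g i - pd i (press γ cv ρ S) x
        - ∑ k, pd k (sigm cs ρ A i k) x - ∑ k, pd k (omeg ch ρ J i k) x) := by
    simp only [← mom, Finset.mul_sum]
    exact Finset.sum_congr rfl fun i _ => by ring
  rw [pdt_add_sum_pd_mul hE hu, hEV, energy1, fderiv_E2 hρ hu, fderiv_E3 hρ hA,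
    fderiv_E4 hρ hJ, fderiv_E3 hρ hφ, fderiv_E4 hρ hψ, mass, ent, energyu, hpd, cleanA, cleanJ]
  simp only [dist, phi, imp, psi, heat, stress, Etot, E2, E3, E4]
  generalize (∑ i, ∑ k, dev (Gm A x) i k * dev (Gm A x) i k) = normA
  generalize (∑ i, ∑ k, dev (Gm φ x) i k * dev (Gm φ x) i k) = normφ
  rw [← hdiv]
  generalize hcurlφ : (fun i k => ∑ j, ∑ l, eps i j l * pd j (φ l k) x) = curlφ
  generalize hcurlA : (fun i k => ∑ j, ∑ l, eps i j l * pd j (A l k) x) = curlA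
  generalize hcurlψ : (fun k => ∑ j, ∑ l, eps k j l * pd j (ψ l) x) = curlψ
  generalize hcurlJ : (fun k => ∑ j, ∑ l, eps k j l * pd j (J l) x) = curlJ
  simp only [funext_iff] at hcurlφ hcurlA hcurlψ hcurlJ
  simp only [hcurlφ, hcurlA, hcurlψ, hcurlJ]
  simp only [Fin.sum_univ_three]
  ring
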